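/- arXiv:1510.03906 — 8 statements merged into one kernel-verified Lean document; each statement's English description precedes it below -/
import Mathlib

section
/- Let u₁, u₂ : ℝ² → ℂ be smooth solutions of the second A₂⁽¹⁾-KdV flow, let k ∈ ℂ, and let h : ℝ² → ℂ be a smooth solution of (BT)_{(u₁,u₂),k}. Then the functions ũ₁ = u₁ − ∂ₓu₂ + 3h·∂ₓh and ũ₂ = u₂ − 3∂ₓh are again a solution of the second A₂⁽¹⁾-KdV flow. -/
/-- Partial derivative in the first (space) variable. -/
noncomputable def px (f : ℝ × ℝ → ℂ) : ℝ × ℝ → ℂ :=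
  fun p => deriv (fun x => f (x, p.2)) p.1

/-- Partial derivative in the second (time) variable. -/
noncomputable def pt (f : ℝ × ℝ → ℂ) : ℝ × ℝ → ℂ :=
  fun p => deriv (fun t => f (p.1, t)) p.2

/-- The second A₂⁽¹⁾-KdV flow. -/
def IsKdV2 (u₁ u₂ : ℝ × ℝ → ℂ) : Prop :=
  (∀ p, pt u₁ p = px (px u₁) p - (2/3 : ℂ) * px (px (px u₂)) p
      + (2/3 : ℂ) * (u₂ p * px u₂ p)) ∧
  (∀ p, pt u₂ p = -(px (px u₂) p) + 2 * px u₁ p)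

/-- The system (BT)_{(u₁,u₂),k}. -/
def IsBT (u₁ u₂ : ℝ × ℝ → ℂ) (k : ℂ) (h : ℝ × ℝ → ℂ) : Prop :=
  (∀ p, px (px h) p = -u₁ p + px u₂ p + h p * u₂ p - 3 * h p * px h p - (h p) ^ 3 - k) ∧
  (∀ p, pt h p = (2/3 : ℂ) * px u₂ p - px (px h) p - 2 * h p * px h p)

abbrev Sm (f : ℝ × ℝ → ℂ) : Prop := ContDiff ℝ (⊤ : ℕ∞) f

lemma Sm.diff {f : ℝ × ℝ → ℂ} (hf : Sm f) : Differentiable ℝ f :=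
  ContDiff.differentiable hf (by simp)

lemma Sm.hasX {f : ℝ × ℝ → ℂ} (hf : Sm f) (p : ℝ × ℝ) :
    HasDerivAt (fun x => f (x, p.2)) (fderiv ℝ f p (1, 0)) p.1 := by
  have h1 : HasFDerivAt f (fderiv ℝ f p) (p.1, p.2) := (hf.diff p).hasFDerivAt
  exact h1.comp_hasDerivAt p.1 ((hasDerivAt_id p.1).prodMk (hasDerivAt_const p.1 p.2))

lemma Sm.hasT {f : ℝ × ℝ → ℂ} (hf : Sm f) (p : ℝ × ℝ) :
    HasDerivAt (fun t => f (p.1, t)) (fderiv ℝ f p (0, 1)) p.2 := by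
  have h1 : HasFDerivAt f (fderiv ℝ f p) (p.1, p.2) := (hf.diff p).hasFDerivAt
  exact h1.comp_hasDerivAt p.2 ((hasDerivAt_const p.2 p.1).prodMk (hasDerivAt_id p.2))

lemma Sm.px_eq {f : ℝ × ℝ → ℂ} (hf : Sm f) : px f = fun p => fderiv ℝ f p (1, 0) :=
  funext fun p => (hf.hasX p).deriv

lemma Sm.pt_eq {f : ℝ × ℝ → ℂ} (hf : Sm f) : pt f = fun p => fderiv ℝ f p (0, 1) :=
  funext fun p => (hf.hasT p).deriv

lemma Sm.fd {f : ℝ × ℝ → ℂ} (hf : Sm f) : ContDiff ℝ (⊤ : ℕ∞) (fderiv ℝ f) :=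
  ContDiff.fderiv_right hf (by simp)

lemma Sm.dx {f : ℝ × ℝ → ℂ} (hf : Sm f) : Sm (px f) := by
  rw [hf.px_eq]; exact hf.fd.clm_apply contDiff_const

lemma Sm.comm {f : ℝ × ℝ → ℂ} (hf : Sm f) : pt (px f) = px (pt f) := by
  have hT : Sm (pt f) := by rw [hf.pt_eq]; exact hf.fd.clm_apply contDiff_const
  rw [hf.dx.pt_eq, hT.px_eq, hf.px_eq, hf.pt_eq]
  funext p
  have hd : DifferentiableAt ℝ (fderiv ℝ f) p := hf.fd.differentiable (by simp) p
  have hs : IsSymmSndFDerivAt ℝ f p :=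
    ContDiffAt.isSymmSndFDerivAt (ContDiff.contDiffAt hf) (by simp only [minSmoothness_of_isRCLikeNormedField]; exact WithTop.coe_le_coe.2 (le_top : (2:ℕ∞) ≤ ⊤))
  rw [fderiv_clm_apply hd (differentiableAt_const _), fderiv_clm_apply hd (differentiableAt_const _)]
  simpa using hs (0, 1) (1, 0)

lemma px_add' {f g : ℝ × ℝ → ℂ} (hf : Sm f) (hg : Sm g) :
    px (fun p => f p + g p) = fun p => px f p + px g p := by
  funext p
  simp only [hf.px_eq, hg.px_eq]
  exact ((hf.hasX p).add (hg.hasX p)).deriv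

lemma px_sub' {f g : ℝ × ℝ → ℂ} (hf : Sm f) (hg : Sm g) :
    px (fun p => f p - g p) = fun p => px f p - px g p := by
  funext p
  simp only [hf.px_eq, hg.px_eq]
  exact ((hf.hasX p).sub (hg.hasX p)).deriv

lemma px_mul' {f g : ℝ × ℝ → ℂ} (hf : Sm f) (hg : Sm g) :
    px (fun p => f p * g p) = fun p => px f p * g p + f p * px g p := by
  funext p
  simp only [hf.px_eq, hg.px_eq]
  exact ((hf.hasX p).mul (hg.hasX p)).deriv

lemma px_neg' {f : ℝ × ℝ → ℂ} (hf : Sm f) :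
    px (fun p => - f p) = fun p => - px f p := by
  funext p
  simp only [hf.px_eq]
  exact ((hf.hasX p).neg).deriv

lemma px_const' (c : ℂ) : px (fun _ => c) = fun _ => 0 := by
  funext p
  simp [px]

lemma px_cmul (c : ℂ) {f : ℝ × ℝ → ℂ} (hf : Sm f) :
    px (fun p => c * f p) = fun p => c * px f p := by
  rw [px_mul' contDiff_const hf, px_const']; simp

lemma pt_add' {f g : ℝ × ℝ → ℂ} (hf : Sm f) (hg : Sm g) :
    pt (fun p => f p + g p) = fun p => pt f p + pt g p := by
  funext p
  simp only [hf.pt_eq, hg.pt_eq]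
  exact ((hf.hasT p).add (hg.hasT p)).deriv

lemma pt_sub' {f g : ℝ × ℝ → ℂ} (hf : Sm f) (hg : Sm g) :
    pt (fun p => f p - g p) = fun p => pt f p - pt g p := by
  funext p
  simp only [hf.pt_eq, hg.pt_eq]
  exact ((hf.hasT p).sub (hg.hasT p)).deriv

lemma pt_mul' {f g : ℝ × ℝ → ℂ} (hf : Sm f) (hg : Sm g) :
    pt (fun p => f p * g p) = fun p => pt f p * g p + f p * pt g p := by
  funext p
  simp only [hf.pt_eq, hg.pt_eq]
  exact ((hf.hasT p).mul (hg.hasT p)).deriv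

lemma pt_cmul (c : ℂ) {f : ℝ × ℝ → ℂ} (hf : Sm f) :
    pt (fun p => c * f p) = fun p => c * pt f p := by
  rw [pt_mul' contDiff_const hf]; funext p; simp [pt]

theorem stmt4 (u₁ u₂ h : ℝ × ℝ → ℂ)
    (hu₁ : ContDiff ℝ (⊤ : ℕ∞) u₁) (hu₂ : ContDiff ℝ (⊤ : ℕ∞) u₂) (hh : ContDiff ℝ (⊤ : ℕ∞) h)
    (hKdV : IsKdV2 u₁ u₂) (k : ℂ) (hBT : IsBT u₁ u₂ k h) :
    IsKdV2 (fun p => u₁ p - px u₂ p + 3 * h p * px h p)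
      (fun p => u₂ p - 3 * px h p) := by
  obtain ⟨e1, e2⟩ := hKdV
  obtain ⟨b1, b2⟩ := hBT
  have a0 : Sm u₁ := hu₁
  have a1 := a0.dx
  have a2 := a1.dx
  have c0 : Sm u₂ := hu₂
  have c1 := c0.dx
  have c2 := c1.dx
  have c3 := c2.dx
  have d0 : Sm h := hh
  have d1 := d0.dx
  have d2 := d1.dx
  have d3 := d2.dx
  have m3 : Sm (fun p => 3 * h p) := contDiff_const.mul d0
  have m31 : Sm (fun p => 3 * px h p) := contDiff_const.mul d1
  have m32 : Sm (fun p => 3 * px (px h) p) := contDiff_const.mul d2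
  have m33 : Sm (fun p => 3 * px (px (px h)) p) := contDiff_const.mul d3
  have hm : Sm (fun p => 3 * h p * px h p) := m3.mul d1
  have X2 : px (fun p => u₂ p - 3 * px h p) = fun p => px u₂ p - 3 * px (px h) p := by
    rw [px_sub' c0 m31, px_cmul 3 d1]
  have X22 : px (fun p => px u₂ p - 3 * px (px h) p)
      = fun p => px (px u₂) p - 3 * px (px (px h)) p := by
    rw [px_sub' c1 m32, px_cmul 3 d2]
  have X222 : px (fun p => px (px u₂) p - 3 * px (px (px h)) p)
      = fun p => px (px (px u₂)) p - 3 * px (px (px (px h))) p := by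
    rw [px_sub' c2 m33, px_cmul 3 d3]
  have M1 : px (fun p => 3 * h p * px h p)
      = fun p => 3 * px h p * px h p + 3 * h p * px (px h) p := by
    rw [px_mul' m3 d1, px_cmul 3 d0]
  have M2 : px (fun p => 3 * px h p * px h p + 3 * h p * px (px h) p)
      = fun p => (3 * px (px h) p * px h p + 3 * px h p * px (px h) p)
        + (3 * px h p * px (px h) p + 3 * h p * px (px (px h)) p) := by
    rw [px_add' (m31.mul d1) (m3.mul d2), px_mul' m31 d1, px_mul' m3 d2, px_cmul 3 d0, px_cmul 3 d1]
  have X1 : px (fun p => u₁ p - px u₂ p + 3 * h p * px h p)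
      = fun p => px u₁ p - px (px u₂) p + (3 * px h p * px h p + 3 * h p * px (px h) p) := by
    rw [px_add' (a0.sub c1) hm, px_sub' a0 c1, M1]
  have X11 : px (fun p => px u₁ p - px (px u₂) p
        + (3 * px h p * px h p + 3 * h p * px (px h) p))
      = fun p => px (px u₁) p - px (px (px u₂)) p
        + ((3 * px (px h) p * px h p + 3 * px h p * px (px h) p)
        + (3 * px h p * px (px h) p + 3 * h p * px (px (px h)) p)) := by
    rw [px_add' (a1.sub c2) ((m31.mul d1).add (m3.mul d2)), px_sub' a1 c2, M2]
  have T2 : pt (fun p => u₂ p - 3 * px h p) = fun p => pt u₂ p - 3 * px (pt h) p := by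
    rw [pt_sub' c0 m31, pt_cmul 3 d1, d0.comm]
  have T1 : pt (fun p => u₁ p - px u₂ p + 3 * h p * px h p)
      = fun p => pt u₁ p - px (pt u₂) p + (3 * pt h p * px h p + 3 * h p * px (pt h) p) := by
    rw [pt_add' (a0.sub c1) hm, pt_sub' a0 c1, pt_mul' m3 d1, pt_cmul 3 d0, c0.comm, d0.comm]
  have HT : px (pt h) = fun p => (2/3 : ℂ) * px (px u₂) p - px (px (px h)) p
      - (2 * px h p * px h p + 2 * h p * px (px h) p) := by
    have m2 : Sm (fun p => 2 * h p) := contDiff_const.mul d0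
    have mc : Sm (fun p => (2/3 : ℂ) * px u₂ p) := contDiff_const.mul c1
    rw [funext b2, px_sub' (mc.sub d2) (m2.mul d1), px_sub' mc d2, px_mul' m2 d1,
      px_cmul 2 d0, px_cmul _ c1]
  have UT : px (pt u₂) = fun p => -(px (px (px u₂)) p) + 2 * px (px u₁) p := by
    rw [funext e2, px_add' c2.neg (contDiff_const.mul a1), px_neg' c2, px_cmul 2 a1]
  have B3 : px (px (px h)) = fun p => -px u₁ p + px (px u₂) p + (px h p * u₂ p + h p * px u₂ p)
      - (3 * px h p * px h p + 3 * h p * px (px h) p) - 3 * (h p * (h p * px h p)) := by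
    have E : px (px h) = fun p => -u₁ p + px u₂ p + h p * u₂ p - 3 * h p * px h p
        - h p * (h p * h p) - k := by
      funext p; rw [b1]; ring
    have hc : Sm (fun p => h p * (h p * h p)) := d0.mul (d0.mul d0)
    have s1 : Sm (fun p => -u₁ p + px u₂ p) := a0.neg.add c1
    have s2 : Sm (fun p => -u₁ p + px u₂ p + h p * u₂ p) := s1.add (d0.mul c0)
    have E' := congrArg px E
    rw [px_sub' ((s2.sub hm).sub hc) contDiff_const, px_sub' (s2.sub hm) hc, px_sub' s2 hm,
      px_add' s1 (d0.mul c0), px_add' a0.neg c1, px_neg' a0, px_mul' d0 c0, M1,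
      px_mul' d0 (d0.mul d0), px_mul' d0 d0, px_const'] at E'
    rw [E']; funext p; ring
  have B4 : px (px (px (px h))) = fun p => -px (px u₁) p + px (px (px u₂)) p
      + ((px (px h) p * u₂ p + px h p * px u₂ p) + (px h p * px u₂ p + h p * px (px u₂) p))
      - ((3 * px (px h) p * px h p + 3 * px h p * px (px h) p)
        + (3 * px h p * px (px h) p + 3 * h p * px (px (px h)) p))
      - 3 * (px h p * (h p * px h p) + h p * (px h p * px h p + h p * px (px h) p)) := by
    have E' := congrArg px B3
    have s1 : Sm (fun p => -px u₁ p + px (px u₂) p) := a1.neg.add c2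
    have s2 : Sm (fun p => px h p * u₂ p + h p * px u₂ p) := (d1.mul c0).add (d0.mul c1)
    have s3 : Sm (fun p => 3 * px h p * px h p + 3 * h p * px (px h) p) :=
      (m31.mul d1).add (m3.mul d2)
    have s4 : Sm (fun p => h p * (h p * px h p)) := d0.mul (d0.mul d1)
    rw [px_sub' ((s1.add s2).sub s3) (contDiff_const.mul s4), px_sub' (s1.add s2) s3,
      px_add' s1 s2, px_add' a1.neg c2, px_neg' a1, px_add' (d1.mul c0) (d0.mul c1),
      px_mul' d1 c0, px_mul' d0 c1, M2, px_cmul 3 s4, px_mul' d0 (d0.mul d1), px_mul' d0 d1] at E'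
    exact E'
  constructor
  · intro p
    rw [X1, X11, X2, X22, X222, T1]
    have f1 := congrFun B4 p
    have f2 := congrFun HT p
    have f3 := congrFun UT p
    simp only at f1 f2 f3 ⊢
    rw [e1, f3, f2, b2, f1]
    ring
  · intro p
    rw [X1, X2, X22, T2]
    have f2 := congrFun HT p
    simp only at f2 ⊢
    rw [f2, e2]
    ring
end

section
/- Let u₁, u₂ : ℝ² → ℂ be smooth solutions of the second A₂⁽¹⁾-KdV flow and let h : ℝ² → ℂ be a smooth solution of the system (bt3). Then the function ∂ₓ²h + u₁ − ∂ₓu₂ − h·u₂ + 3h·∂ₓh + h³ is constant on ℝ²; equivalently, there exists a constant k ∈ ℂ such that h is a solution of (BT)_{(u₁,u₂),k}. -/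
/-- The Bäcklund transformation `h ∗ (u₁, u₂)`. -/
noncomputable def btStar (h u₁ u₂ : ℝ × ℝ → ℂ) : (ℝ × ℝ → ℂ) × (ℝ × ℝ → ℂ) :=
  (fun p => u₁ p - px u₂ p + 3 * h p * px h p, fun p => u₂ p - 3 * px h p)

lemma px_eq (f : ℝ × ℝ → ℂ) (hf : ContDiff ℝ (⊤ : ℕ∞) f) (p : ℝ × ℝ) :
    HasDerivAt (fun x => f (x, p.2)) (fderiv ℝ f p (1, 0)) p.1 := by
  have h1 : HasFDerivAt f (fderiv ℝ f p) (p.1, p.2) :=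
    (hf.differentiable (by simp) p).hasFDerivAt
  exact h1.comp_hasDerivAt p.1 ((hasDerivAt_id p.1).prodMk (hasDerivAt_const p.1 p.2))

lemma pt_eq (f : ℝ × ℝ → ℂ) (hf : ContDiff ℝ (⊤ : ℕ∞) f) (p : ℝ × ℝ) :
    HasDerivAt (fun t => f (p.1, t)) (fderiv ℝ f p (0, 1)) p.2 := by
  have h1 : HasFDerivAt f (fderiv ℝ f p) (p.1, p.2) :=
    (hf.differentiable (by simp) p).hasFDerivAt
  exact h1.comp_hasDerivAt p.2 ((hasDerivAt_const p.2 p.1).prodMk (hasDerivAt_id p.2))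

lemma px_fun (f : ℝ × ℝ → ℂ) (hf : ContDiff ℝ (⊤ : ℕ∞) f) :
    px f = fun p => fderiv ℝ f p (1, 0) := by
  funext p; exact (px_eq f hf p).deriv

lemma pt_fun (f : ℝ × ℝ → ℂ) (hf : ContDiff ℝ (⊤ : ℕ∞) f) :
    pt f = fun p => fderiv ℝ f p (0, 1) := by
  funext p; exact (pt_eq f hf p).deriv

lemma px_smooth {f : ℝ × ℝ → ℂ} (hf : ContDiff ℝ (⊤ : ℕ∞) f) :
    ContDiff ℝ (⊤ : ℕ∞) (px f) := by
  rw [px_fun f hf]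
  exact (hf.fderiv_right (m := (⊤ : ℕ∞)) (by simp)).clm_apply contDiff_const

lemma pt_px {f : ℝ × ℝ → ℂ} (hf : ContDiff ℝ (⊤ : ℕ∞) f) (p : ℝ × ℝ) :
    pt (px f) p = px (pt f) p := by
  have hd : ContDiff ℝ (⊤ : ℕ∞) (fderiv ℝ f) := hf.fderiv_right (by simp)
  have hdd : DifferentiableAt ℝ (fderiv ℝ f) p := hd.differentiable (by simp) p
  have hpt : ContDiff ℝ (⊤ : ℕ∞) (pt f) := by
    rw [pt_fun f hf]
    exact hd.clm_apply contDiff_const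
  rw [pt_fun _ (px_smooth hf), px_fun _ hpt, px_fun f hf, pt_fun f hf]
  have key : IsSymmSndFDerivAt ℝ f p :=
    (hf.contDiffAt).isSymmSndFDerivAt (by simp; exact WithTop.coe_le_coe.2 (le_top (a := (2 : ℕ∞))))
  simp only [fderiv_clm_apply hdd (differentiableAt_const _)]
  simpa using key.eq (0, 1) (1, 0)

lemma hx {f : ℝ × ℝ → ℂ} (hf : ContDiff ℝ (⊤ : ℕ∞) f) (p : ℝ × ℝ) :
    HasDerivAt (fun x => f (x, p.2)) (px f p) p.1 :=
  (px_eq f hf p).differentiableAt.hasDerivAt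

lemma ht {f : ℝ × ℝ → ℂ} (hf : ContDiff ℝ (⊤ : ℕ∞) f) (p : ℝ × ℝ) :
    HasDerivAt (fun t => f (p.1, t)) (pt f p) p.2 :=
  (pt_eq f hf p).differentiableAt.hasDerivAt

lemma const_of {G : ℝ × ℝ → ℂ} (hG : ContDiff ℝ (⊤ : ℕ∞) G) (h1 : ∀ p, px G p = 0)
    (h2 : ∀ p, pt G p = 0) (p q : ℝ × ℝ) : G p = G q := by
  have a : G (p.1, p.2) = G (q.1, p.2) :=
    is_const_of_deriv_eq_zero (f := fun x => G (x, p.2))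
      (fun x => (hx hG (x, p.2)).differentiableAt) (fun x => h1 (x, p.2)) _ _
  have b : G (q.1, p.2) = G (q.1, q.2) :=
    is_const_of_deriv_eq_zero (f := fun t => G (q.1, t))
      (fun t => (ht hG (q.1, t)).differentiableAt) (fun t => h2 (q.1, t)) _ _
  exact a.trans b

/-- Every solution of the system (bt3) is a solution of (BT)_{(u₁,u₂),k} for some
constant k; equivalently `∂ₓ²h + u₁ − ∂ₓu₂ − h·u₂ + 3h·∂ₓh + h³` is constant. -/
theorem stmt5 (u₁ u₂ h : ℝ × ℝ → ℂ)
    (hu₁ : ContDiff ℝ (⊤ : ℕ∞) u₁) (hu₂ : ContDiff ℝ (⊤ : ℕ∞) u₂) (hh : ContDiff ℝ (⊤ : ℕ∞) h)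
    (hKdV : IsKdV2 u₁ u₂)
    (hbt3x : ∀ p, px (px (px h)) p =
      px (fun q => -u₁ q + px u₂ q + h q * u₂ q - 3 * h q * px h q - (h q) ^ 3) p)
    (hbt3t : ∀ p, pt h p = (2/3 : ℂ) * px u₂ p - px (px h) p - 2 * h p * px h p) :
    (∀ p q : ℝ × ℝ,
        px (px h) p + u₁ p - px u₂ p - h p * u₂ p + 3 * h p * px h p + (h p) ^ 3 =
        px (px h) q + u₁ q - px u₂ q - h q * u₂ q + 3 * h q * px h q + (h q) ^ 3) ∧
    ∃ k : ℂ, IsBT u₁ u₂ k h := by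
  obtain ⟨k1, k2⟩ := hKdV
  have hh1 := px_smooth hh
  have hh2 := px_smooth hh1
  have hh3 := px_smooth hh2
  have ha1 := px_smooth hu₁
  have hv1 := px_smooth hu₂
  have hv2 := px_smooth hv1
  -- third derivative of `h`
  have e3 : ∀ p, px (px (px h)) p = -px u₁ p + px (px u₂) p + (px h p * u₂ p + h p * px u₂ p)
      - (3 * px h p * px h p + 3 * h p * px (px h) p) - 3 * h p ^ 2 * px h p := by
    intro p
    rw [hbt3x p]
    refine HasDerivAt.deriv ?_
    have := (((((hx hu₁ p).neg).add (hx hv1 p)).add ((hx hh p).mul (hx hu₂ p))).sub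
      (((hx hh p).const_mul 3).mul (hx hh1 p))).sub ((hx hh p).pow 3)
    refine this.congr_deriv ?_
    push_cast
    ring
  -- fourth derivative of `h`
  have e4 : ∀ p, px (px (px (px h))) p = -px (px u₁) p + px (px (px u₂)) p
      + (px (px h) p * u₂ p + 2 * px h p * px u₂ p + h p * px (px u₂) p)
      - (9 * px h p * px (px h) p + 3 * h p * px (px (px h)) p)
      - (6 * h p * px h p ^ 2 + 3 * h p ^ 2 * px (px h) p) := by
    intro p
    conv_lhs => rw [show px (px (px h)) = _ from funext e3]
    refine HasDerivAt.deriv ?_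
    have := (((((hx ha1 p).neg).add (hx hv2 p)).add
      (((hx hh1 p).mul (hx hu₂ p)).add ((hx hh p).mul (hx hv1 p)))).sub
      ((((hx hh1 p).const_mul 3).mul (hx hh1 p)).add
        (((hx hh p).const_mul 3).mul (hx hh2 p)))).sub
      ((((hx hh p).pow 2).const_mul 3).mul (hx hh1 p))
    refine this.congr_deriv ?_
    simp only [Pi.pow_apply]
    push_cast
    ring
  have t1 : ∀ p, pt (px h) p = (2/3 : ℂ) * px (px u₂) p - px (px (px h)) p
      - 2 * (px h p ^ 2 + h p * px (px h) p) := by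
    intro p
    rw [pt_px hh p, show pt h = _ from funext hbt3t]
    refine HasDerivAt.deriv ?_
    have := (((hx hv1 p).const_mul (2/3 : ℂ)).sub (hx hh2 p)).sub
      (((hx hh p).const_mul 2).mul (hx hh1 p))
    refine this.congr_deriv ?_
    ring
  have t2 : ∀ p, pt (px (px h)) p = (2/3 : ℂ) * px (px (px u₂)) p - px (px (px (px h))) p
      - 2 * (3 * px h p * px (px h) p + h p * px (px (px h)) p) := by
    intro p
    rw [pt_px hh1 p, show pt (px h) = _ from funext t1]
    refine HasDerivAt.deriv ?_
    have := (((hx hv2 p).const_mul (2/3 : ℂ)).sub (hx hh3 p)).sub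
      ((((hx hh1 p).pow 2).add ((hx hh p).mul (hx hh2 p))).const_mul 2)
    refine this.congr_deriv ?_
    push_cast
    ring
  have tv : ∀ p, pt (px u₂) p = -px (px (px u₂)) p + 2 * px (px u₁) p := by
    intro p
    rw [pt_px hu₂ p, show pt u₂ = _ from funext k2]
    exact ((hx hv2 p).neg.add ((hx ha1 p).const_mul 2)).deriv
  have main : ∀ p q : ℝ × ℝ,
        px (px h) p + u₁ p - px u₂ p - h p * u₂ p + 3 * h p * px h p + (h p) ^ 3 =
        px (px h) q + u₁ q - px u₂ q - h q * u₂ q + 3 * h q * px h q + (h q) ^ 3 := by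
    refine const_of (G := fun p => px (px h) p + u₁ p - px u₂ p - h p * u₂ p
      + 3 * h p * px h p + (h p) ^ 3) ?_ ?_ ?_
    · exact ((((hh2.add hu₁).sub hv1).sub (hh.mul hu₂)).add
        ((contDiff_const.mul hh).mul hh1)).add (hh.pow 3)
    · intro p
      refine HasDerivAt.deriv ?_
      have := (((((hx hh2 p).add (hx hu₁ p)).sub (hx hv1 p)).sub ((hx hh p).mul (hx hu₂ p))).add
        (((hx hh p).const_mul 3).mul (hx hh1 p))).add ((hx hh p).pow 3)
      refine this.congr_deriv ?_
      push_cast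
      linear_combination e3 p
    · intro p
      refine HasDerivAt.deriv ?_
      have := (((((ht hh2 p).add (ht hu₁ p)).sub (ht hv1 p)).sub ((ht hh p).mul (ht hu₂ p))).add
        (((ht hh p).const_mul 3).mul (ht hh1 p))).add ((ht hh p).pow 3)
      refine this.congr_deriv ?_
      rw [t2, t1, tv, k1, k2, hbt3t]
      push_cast
      linear_combination -e4 p - 2 * h p * e3 p
  refine ⟨main, -(px (px h) 0 + u₁ 0 - px u₂ 0 - h 0 * u₂ 0 + 3 * h 0 * px h 0 + (h 0) ^ 3),
    ?_, hbt3t⟩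
  intro p
  linear_combination main p 0
end

section
/- Let u₁, u₂, v₁, v₂, v₃ : ℝ → ℂ be smooth functions and k ∈ ℂ, and suppose v₁' = −(k + u₁)·v₃, v₂' = −v₁ − u₂·v₃, v₃' = −v₂ on ℝ, with v₃ nowhere zero. Then the function h := −v₂/v₃ satisfies h'' = −u₁ + u₂' + h·u₂ − 3h·h' − h³ − k on ℝ. -/
/-- The linear system `v' = −(k·e₁₃ + b + u)v` produces a solution `h = −v₂/v₃`
of the x-equation of the Bäcklund transformation system for the second
A₂⁽¹⁾-KdV flow with parameter k. -/
theorem stmt7 (u₁ u₂ v₁ v₂ v₃ : ℝ → ℂ) (k : ℂ)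
    (hu₁ : ContDiff ℝ (⊤ : ℕ∞) u₁) (hu₂ : ContDiff ℝ (⊤ : ℕ∞) u₂)
    (hv₁ : ContDiff ℝ (⊤ : ℕ∞) v₁) (hv₂ : ContDiff ℝ (⊤ : ℕ∞) v₂) (hv₃ : ContDiff ℝ (⊤ : ℕ∞) v₃)
    (e₁ : ∀ x, deriv v₁ x = -(k + u₁ x) * v₃ x)
    (e₂ : ∀ x, deriv v₂ x = -v₁ x - u₂ x * v₃ x)
    (e₃ : ∀ x, deriv v₃ x = -v₂ x)
    (hne : ∀ x, v₃ x ≠ 0) :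
    ∀ x, deriv (deriv (fun y => -v₂ y / v₃ y)) x =
      -u₁ x + deriv u₂ x + (-v₂ x / v₃ x) * u₂ x
        - 3 * (-v₂ x / v₃ x) * deriv (fun y => -v₂ y / v₃ y) x
        - (-v₂ x / v₃ x) ^ 3 - k := by
  have d₁ : ∀ x, HasDerivAt v₁ (-(k + u₁ x) * v₃ x) x := fun x =>
    e₁ x ▸ (hv₁.differentiable (by simp) x).hasDerivAt
  have d₂ : ∀ x, HasDerivAt v₂ (-v₁ x - u₂ x * v₃ x) x := fun x =>
    e₂ x ▸ (hv₂.differentiable (by simp) x).hasDerivAt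
  have d₃ : ∀ x, HasDerivAt v₃ (-v₂ x) x := fun x =>
    e₃ x ▸ (hv₃.differentiable (by simp) x).hasDerivAt
  have du : ∀ x, HasDerivAt u₂ (deriv u₂ x) x := fun x =>
    (hu₂.differentiable (by simp) x).hasDerivAt
  have dh : ∀ x, HasDerivAt (fun y => -v₂ y / v₃ y)
      (v₁ x / v₃ x + u₂ x - (-v₂ x / v₃ x) ^ 2) x := by
    intro x
    have h := (d₂ x).fun_neg.fun_div (d₃ x) (hne x)
    refine h.congr_deriv ?_
    have := hne x
    field_simp
    ring
  have hd : deriv (fun y => -v₂ y / v₃ y) =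
      fun x => v₁ x / v₃ x + u₂ x - (-v₂ x / v₃ x) ^ 2 := funext fun x => (dh x).deriv
  intro x
  rw [hd]
  have h := (((d₁ x).fun_div (d₃ x) (hne x)).fun_add (du x)).fun_sub ((dh x).fun_pow 2)
  rw [h.deriv]
  have := hne x
  rw [show (2 - 1 : ℕ) = 1 from rfl, pow_one]
  push_cast
  field_simp
  ring
end

section
/- Let u₁, u₂ : ℝ² → ℂ be smooth solutions of the second A₂⁽¹⁾-KdV flow, let r ∈ ℝ with r ≠ 0, and define the scaled solution (r·u)₁(x,t) = r³·u₁(rx, r²t), (r·u)₂(x,t) = r²·u₂(rx, r²t). Suppose h is a smooth solution of (BT)_{((r·u)₁,(r·u)₂),1}. Then ĥ(x,t) := r⁻¹·h(r⁻¹x, r⁻²t) is a solution of (BT)_{(u₁,u₂), r⁻³}. -/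
theorem px_scale (c : ℂ) (a b : ℝ) (f : ℝ × ℝ → ℂ) :
    px (fun p => c * f (a * p.1, b * p.2)) = fun p => (c * a) * px f (a * p.1, b * p.2) := by
  funext p
  have h := deriv_comp_mul_left a (fun x => f (x, b * p.2)) p.1
  simp only [px]
  rw [deriv_const_mul_field, h, Complex.real_smul, mul_assoc]

theorem pt_scale (c : ℂ) (a b : ℝ) (f : ℝ × ℝ → ℂ) :
    pt (fun p => c * f (a * p.1, b * p.2)) = fun p => (c * b) * pt f (a * p.1, b * p.2) := by
  funext p
  have h := deriv_comp_mul_left b (fun x => f (a * p.1, x)) p.2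
  simp only [pt]
  rw [deriv_const_mul_field, h, Complex.real_smul, mul_assoc]

/-- Conjugating a Bäcklund transformation with parameter 1 by the r-scaling
transform gives a Bäcklund transformation with parameter r⁻³. -/
theorem stmt11 (u₁ u₂ h : ℝ × ℝ → ℂ)
    (hu₁ : ContDiff ℝ (⊤ : ℕ∞) u₁) (hu₂ : ContDiff ℝ (⊤ : ℕ∞) u₂) (hh : ContDiff ℝ (⊤ : ℕ∞) h)
    (hKdV : IsKdV2 u₁ u₂) (r : ℝ) (hr : r ≠ 0)
    (hBT : IsBT (fun p => (r : ℂ) ^ 3 * u₁ (r * p.1, r ^ 2 * p.2))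
      (fun p => (r : ℂ) ^ 2 * u₂ (r * p.1, r ^ 2 * p.2)) 1 h) :
    IsBT u₁ u₂ ((r : ℂ) ^ 3)⁻¹
      (fun p => (r : ℂ)⁻¹ * h (r⁻¹ * p.1, (r ^ 2)⁻¹ * p.2)) := by
  have hc : (r : ℂ) ≠ 0 := by exact_mod_cast hr
  obtain ⟨h1, h2⟩ := hBT
  have key : ∀ p : ℝ × ℝ, (r * (r⁻¹ * p.1), r ^ 2 * ((r ^ 2)⁻¹ * p.2)) = p := by
    intro p
    ext
    · simp [hr]
    · simp [hr]
  refine ⟨fun p => ?_, fun p => ?_⟩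
  · have e := h1 (r⁻¹ * p.1, (r ^ 2)⁻¹ * p.2)
    rw [px_scale] at e
    simp only [key] at e
    rw [px_scale, px_scale]
    simp only [e]
    push_cast
    field_simp
    try ring
  · have e := h2 (r⁻¹ * p.1, (r ^ 2)⁻¹ * p.2)
    rw [px_scale] at e
    simp only [key] at e
    rw [px_scale, px_scale, pt_scale]
    simp only [e]
    push_cast
    field_simp
    try ring
end

section
/- Let a₁, a₂ ∈ ℂ, let D(x,t) = 1 + a₁(x²/2 − t) − a₂x, and let Ω = {(x,t) ∈ ℝ² : D(x,t) ≠ 0}. Then the function h = (a₁x − a₂)/D satisfies, at every point of Ω, the equations ∂ₓ²h = −3h·∂ₓh − h³ and ∂ₜh = −∂ₓ²h − 2h·∂ₓh; that is, h solves (BT)_{(0,0),0} on Ω. -/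
/-- The rational function `h = (a₁x − a₂)/D` solves (BT)_{(0,0),0} on the set
where `D = 1 + a₁(x²/2 − t) − a₂x` is nonzero. -/
theorem stmt13 (a₁ a₂ : ℂ)
    (D h : ℝ × ℝ → ℂ)
    (hD : ∀ p, D p = 1 + a₁ * ((p.1 : ℂ) ^ 2 / 2 - (p.2 : ℂ)) - a₂ * (p.1 : ℂ))
    (hhd : ∀ p, h p = (a₁ * (p.1 : ℂ) - a₂) / D p) :
    ∀ p : ℝ × ℝ, D p ≠ 0 →
      (px (px h) p = -3 * h p * px h p - (h p) ^ 3 ∧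
       pt h p = -(px (px h) p) - 2 * h p * px h p) := by
  have hDx : ∀ (t x : ℝ), HasDerivAt (fun y : ℝ => D (y, t)) (a₁ * (x : ℂ) - a₂) x := by
    intro t x
    have hid : HasDerivAt (fun y : ℝ => (y : ℂ)) 1 x := Complex.ofRealCLM.hasDerivAt
    have h1 := ((((hid.pow 2).div_const 2).sub_const (t : ℂ)).const_mul a₁).const_add 1
    have h2 := h1.sub (hid.const_mul a₂)
    have e : (fun y : ℝ => D (y, t)) = fun y : ℝ =>
        1 + a₁ * ((y : ℂ) ^ 2 / 2 - (t : ℂ)) - a₂ * (y : ℂ) := by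
      funext y; rw [hD]
    rw [e]
    refine h2.congr_deriv ?_
    simp
  have hNx : ∀ x : ℝ, HasDerivAt (fun y : ℝ => a₁ * (y : ℂ) - a₂) a₁ x := by
    intro x
    have hid : HasDerivAt (fun y : ℝ => (y : ℂ)) 1 x := Complex.ofRealCLM.hasDerivAt
    exact ((hid.const_mul a₁).sub_const a₂).congr_deriv (by simp)
  have hhx : ∀ (t x : ℝ), D (x, t) ≠ 0 →
      HasDerivAt (fun y : ℝ => h (y, t)) (a₁ / D (x, t) - h (x, t) ^ 2) x := by
    intro t x hne
    have e : (fun y : ℝ => h (y, t)) = fun y : ℝ => (a₁ * (y : ℂ) - a₂) / D (y, t) := by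
      funext y; rw [hhd]
    rw [e]
    refine ((hNx x).fun_div (hDx t x) hne).congr_deriv ?_
    rw [hhd]
    field_simp
  rintro ⟨x, t⟩ hne
  have hpx : ∀ y : ℝ, D (y, t) ≠ 0 → px h (y, t) = a₁ / D (y, t) - h (y, t) ^ 2 :=
    fun y hy => (hhx t y hy).deriv
  have hev : (fun y : ℝ => px h (y, t)) =ᶠ[nhds x]
      fun y : ℝ => a₁ / D (y, t) - h (y, t) ^ 2 := by
    filter_upwards [(hDx t x).continuousAt.eventually_ne hne] with y hy
    exact hpx y hy
  have hpxx : px (px h) (x, t) = -a₁ * (a₁ * (x : ℂ) - a₂) / D (x, t) ^ 2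
      - 2 * h (x, t) * (a₁ / D (x, t) - h (x, t) ^ 2) := by
    have h3 := ((hasDerivAt_const x a₁).fun_div (hDx t x) hne).fun_sub ((hhx t x hne).fun_pow 2)
    have h4 := (h3.congr_of_eventuallyEq hev).deriv
    change deriv (fun y : ℝ => px h (y, t)) x = _
    rw [h4]
    simp
  have hpt : pt h (x, t) = a₁ * (a₁ * (x : ℂ) - a₂) / D (x, t) ^ 2 := by
    have hid : HasDerivAt (fun y : ℝ => (y : ℂ)) 1 t := Complex.ofRealCLM.hasDerivAt
    have hDt : HasDerivAt (fun s : ℝ => D (x, s)) (-a₁) t := by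
      have e : (fun s : ℝ => D (x, s)) = fun s : ℝ =>
          1 + a₁ * ((x : ℂ) ^ 2 / 2 - (s : ℂ)) - a₂ * (x : ℂ) := by
        funext y; rw [hD]
      rw [e]
      exact ((((hid.const_sub ((x : ℂ) ^ 2 / 2)).const_mul a₁).const_add 1).sub_const
        (a₂ * (x : ℂ))).congr_deriv (by simp)
    have h5 := ((hasDerivAt_const t (a₁ * (x : ℂ) - a₂)).fun_div hDt hne).deriv
    change deriv (fun s : ℝ => h (x, s)) t = _
    have e : (fun s : ℝ => h (x, s)) = fun s : ℝ => (a₁ * (x : ℂ) - a₂) / D (x, s) := by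
      funext y; rw [hhd]
    rw [e, h5]
    ring
  rw [hpxx, hpt, hpx x hne, hhd (x, t)]
  constructor <;> (simp only []; field_simp; ring)
end

section
/- Let a₁, a₂ ∈ ℂ, let D(x,t) = 1 + a₁(x²/2 − t) − a₂x and S(x,t) = (1/2)a₁²x² − a₁a₂x + a₁²t + a₂² − a₁, and let Ω = {(x,t) ∈ ℝ² : D(x,t) ≠ 0}. Then the functions u₁ = −3(a₁x − a₂)·S/D³ and u₂ = 3S/D² satisfy, at every point of Ω, the equations of the second A₂⁽¹⁾-KdV flow: ∂ₜu₁ = ∂ₓ²u₁ − (2/3)∂ₓ³u₂ + (2/3)u₂·∂ₓu₂ and ∂ₜu₂ = −∂ₓ²u₂ + 2∂ₓu₁. -/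
/-- Locality of `px`: replace `f` by a function agreeing with it where `D ≠ 0`. -/
theorem px_of_eqOn {D f g : ℝ × ℝ → ℂ} (hc : Continuous D)
    (h : ∀ p, D p ≠ 0 → f p = g p) {p : ℝ × ℝ} (hp : D p ≠ 0) {c : ℂ}
    (hg : HasDerivAt (fun x => g (x, p.2)) c p.1) : px f p = c := by
  have hc' : Continuous (fun x : ℝ => D (x, p.2)) := by fun_prop
  have hev : ∀ᶠ x in nhds p.1, D (x, p.2) ≠ 0 := hc'.continuousAt.eventually_ne hp
  exact (hg.congr_of_eventuallyEq (hev.mono fun x hx => h (x, p.2) hx)).deriv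

/-- Locality of `pt`. -/
theorem pt_of_eqOn {D f g : ℝ × ℝ → ℂ} (hc : Continuous D)
    (h : ∀ p, D p ≠ 0 → f p = g p) {p : ℝ × ℝ} (hp : D p ≠ 0) {c : ℂ}
    (hg : HasDerivAt (fun t => g (p.1, t)) c p.2) : pt f p = c := by
  have hc' : Continuous (fun t : ℝ => D (p.1, t)) := by fun_prop
  have hev : ∀ᶠ t in nhds p.2, D (p.1, t) ≠ 0 := hc'.continuousAt.eventually_ne hp
  exact (hg.congr_of_eventuallyEq (hev.mono fun t ht => h (p.1, t) ht)).deriv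

/-- Derivative of a monomial `c * w ^ m * v ^ n`. -/
theorem hasDerivAt_monomial {w v : ℝ → ℂ} {w' v' : ℂ} {x : ℝ} (hw : HasDerivAt w w' x)
    (hv : HasDerivAt v v' x) (c : ℂ) (m n : ℕ) :
    HasDerivAt (fun y => c * (w y ^ m * v y ^ n))
      (c * ((m * w x ^ (m - 1) * w') * v x ^ n + w x ^ m * (n * v x ^ (n - 1) * v'))) x :=
  ((hw.fun_pow m).fun_mul (hv.fun_pow n)).const_mul c

/-- The rational functions `u₁ = −3(a₁x−a₂)S/D³`, `u₂ = 3S/D²` solve the second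
A₂⁽¹⁾-KdV flow on the set where `D` is nonzero. -/
theorem stmt14 (a₁ a₂ : ℂ)
    (D S u₁ u₂ : ℝ × ℝ → ℂ)
    (hD : ∀ p, D p = 1 + a₁ * ((p.1 : ℂ) ^ 2 / 2 - (p.2 : ℂ)) - a₂ * (p.1 : ℂ))
    (hS : ∀ p, S p = (1/2 : ℂ) * a₁ ^ 2 * (p.1 : ℂ) ^ 2 - a₁ * a₂ * (p.1 : ℂ)
        + a₁ ^ 2 * (p.2 : ℂ) + a₂ ^ 2 - a₁)
    (hu₁ : ∀ p, u₁ p = -3 * (a₁ * (p.1 : ℂ) - a₂) * S p / (D p) ^ 3)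
    (hu₂ : ∀ p, u₂ p = 3 * S p / (D p) ^ 2) :
    ∀ p : ℝ × ℝ, D p ≠ 0 →
      (pt u₁ p = px (px u₁) p - (2/3 : ℂ) * px (px (px u₂)) p
          + (2/3 : ℂ) * (u₂ p * px u₂ p) ∧
       pt u₂ p = -(px (px u₂) p) + 2 * px u₁ p) := by
  have hc : Continuous D := by
    have : D = fun p : ℝ × ℝ =>
        1 + a₁ * ((p.1 : ℂ) ^ 2 / 2 - (p.2 : ℂ)) - a₂ * (p.1 : ℂ) := funext hD
    rw [this]; fun_prop
  obtain ⟨w, hw⟩ : ∃ w : ℝ × ℝ → ℂ, ∀ p, w p = a₁ * (p.1 : ℂ) - a₂ := ⟨_, fun _ => rfl⟩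
  obtain ⟨v, hv⟩ : ∃ v : ℝ × ℝ → ℂ, ∀ p, v p = (D p)⁻¹ := ⟨_, fun _ => rfl⟩
  have hSw : ∀ p, S p = w p ^ 2 - a₁ * D p := by
    intro p; rw [hS, hw, hD]; ring
  have hwx : ∀ p : ℝ × ℝ, HasDerivAt (fun x => w (x, p.2)) a₁ p.1 := by
    intro p
    simp only [hw]
    simpa using ((Complex.ofRealCLM.hasDerivAt (x := p.1)).const_mul a₁).sub_const a₂
  have hwt : ∀ p : ℝ × ℝ, HasDerivAt (fun t => w (p.1, t)) 0 p.2 := by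
    intro p
    simp only [hw]
    exact hasDerivAt_const _ _
  have hDx : ∀ p : ℝ × ℝ, HasDerivAt (fun x => D (x, p.2)) (w p) p.1 := by
    intro p
    simp only [hD, hw]
    have h0 : HasDerivAt (fun x : ℝ => (x : ℂ)) 1 p.1 := by
      exact (Complex.ofRealCLM.hasDerivAt (x := p.1)).congr_deriv (by simp)
    refine ((((((h0.fun_pow 2).div_const 2).sub_const (p.2 : ℂ)).const_mul a₁).const_add 1).fun_sub
      (h0.const_mul a₂)).congr_deriv ?_
    push_cast; ring
  have hDt : ∀ p : ℝ × ℝ, HasDerivAt (fun t => D (p.1, t)) (-a₁) p.2 := by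
    intro p
    simp only [hD]
    have h0 : HasDerivAt (fun x : ℝ => (x : ℂ)) 1 p.2 := by
      exact (Complex.ofRealCLM.hasDerivAt (x := p.2)).congr_deriv (by simp)
    refine ((((h0.const_sub ((p.1 : ℂ) ^ 2 / 2)).const_mul a₁).const_add 1).sub_const
      (a₂ * (p.1 : ℂ))).congr_deriv ?_
    ring
  have hvx : ∀ p : ℝ × ℝ, D p ≠ 0 →
      HasDerivAt (fun x => v (x, p.2)) (-(w p * v p ^ 2)) p.1 := by
    intro p hp
    have := (hDx p).fun_inv hp
    simp only [hv]
    refine this.congr_deriv ?_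
    simp only [Prod.mk.eta]; field_simp
  have hvt : ∀ p : ℝ × ℝ, D p ≠ 0 →
      HasDerivAt (fun t => v (p.1, t)) (a₁ * v p ^ 2) p.2 := by
    intro p hp
    have := (hDt p).fun_inv hp
    simp only [hv]
    refine this.congr_deriv ?_
    simp only [Prod.mk.eta]; field_simp
  -- monomial expansions of the functions and their derivatives
  have e1 : ∀ p, D p ≠ 0 →
      u₁ p = -3 * (w p ^ 3 * v p ^ 3) + 3 * a₁ * (w p ^ 1 * v p ^ 2) := by
    intro p hp
    rw [hu₁, hSw, ← hw, hv]; field_simp; ring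
  have e2 : ∀ p, D p ≠ 0 →
      u₂ p = 3 * (w p ^ 2 * v p ^ 2) + -3 * a₁ * (w p ^ 0 * v p ^ 1) := by
    intro p hp
    rw [hu₂, hSw, hv]; field_simp; ring
  have e1x : ∀ p, D p ≠ 0 →
      px u₁ p = 3 * a₁ ^ 2 * (w p ^ 0 * v p ^ 2) + -15 * a₁ * (w p ^ 2 * v p ^ 3)
        + 9 * (w p ^ 4 * v p ^ 4) := by
    intro p hp
    refine (px_of_eqOn hc e1 hp ((hasDerivAt_monomial (hwx p) (hvx p hp) _ _ _).fun_add
      (hasDerivAt_monomial (hwx p) (hvx p hp) _ _ _))).trans ?_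
    simp only [Prod.mk.eta]; push_cast; ring
  have e2x : ∀ p, D p ≠ 0 →
      px u₂ p = 9 * a₁ * (w p ^ 1 * v p ^ 2) + -6 * (w p ^ 3 * v p ^ 3) := by
    intro p hp
    refine (px_of_eqOn hc e2 hp ((hasDerivAt_monomial (hwx p) (hvx p hp) _ _ _).fun_add
      (hasDerivAt_monomial (hwx p) (hvx p hp) _ _ _))).trans ?_
    simp only [Prod.mk.eta]; push_cast; ring
  have e2xx : ∀ p, D p ≠ 0 →
      px (px u₂) p = 9 * a₁ ^ 2 * (w p ^ 0 * v p ^ 2) + -36 * a₁ * (w p ^ 2 * v p ^ 3)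
        + 18 * (w p ^ 4 * v p ^ 4) := by
    intro p hp
    refine (px_of_eqOn hc e2x hp ((hasDerivAt_monomial (hwx p) (hvx p hp) _ _ _).fun_add
      (hasDerivAt_monomial (hwx p) (hvx p hp) _ _ _))).trans ?_
    simp only [Prod.mk.eta]; push_cast; ring
  have e1xx : ∀ p, D p ≠ 0 →
      px (px u₁) p = -36 * a₁ ^ 2 * (w p * v p ^ 3) + 81 * a₁ * (w p ^ 3 * v p ^ 4)
        + -36 * (w p ^ 5 * v p ^ 5) := by
    intro p hp
    refine (px_of_eqOn hc e1x hp (((hasDerivAt_monomial (hwx p) (hvx p hp) _ _ _).fun_add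
      (hasDerivAt_monomial (hwx p) (hvx p hp) _ _ _)).fun_add
      (hasDerivAt_monomial (hwx p) (hvx p hp) _ _ _))).trans ?_
    simp only [Prod.mk.eta]; push_cast; ring
  have e2xxx : ∀ p, D p ≠ 0 →
      px (px (px u₂)) p = -90 * a₁ ^ 2 * (w p * v p ^ 3) + 180 * a₁ * (w p ^ 3 * v p ^ 4)
        + -72 * (w p ^ 5 * v p ^ 5) := by
    intro p hp
    refine (px_of_eqOn hc e2xx hp (((hasDerivAt_monomial (hwx p) (hvx p hp) _ _ _).fun_add
      (hasDerivAt_monomial (hwx p) (hvx p hp) _ _ _)).fun_add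
      (hasDerivAt_monomial (hwx p) (hvx p hp) _ _ _))).trans ?_
    simp only [Prod.mk.eta]; push_cast; ring
  have e1t : ∀ p, D p ≠ 0 →
      pt u₁ p = 6 * a₁ ^ 2 * (w p * v p ^ 3) - 9 * a₁ * (w p ^ 3 * v p ^ 4) := by
    intro p hp
    refine (pt_of_eqOn hc e1 hp ((hasDerivAt_monomial (hwt p) (hvt p hp) _ _ _).fun_add
      (hasDerivAt_monomial (hwt p) (hvt p hp) _ _ _))).trans ?_
    simp only [Prod.mk.eta]; push_cast; ring
  have e2t : ∀ p, D p ≠ 0 →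
      pt u₂ p = 6 * a₁ * (w p ^ 2 * v p ^ 3) - 3 * a₁ ^ 2 * v p ^ 2 := by
    intro p hp
    refine (pt_of_eqOn hc e2 hp ((hasDerivAt_monomial (hwt p) (hvt p hp) _ _ _).fun_add
      (hasDerivAt_monomial (hwt p) (hvt p hp) _ _ _))).trans ?_
    simp only [Prod.mk.eta]; push_cast; ring
  intro p hp
  constructor
  · rw [e1t p hp, e1xx p hp, e2xxx p hp, e2 p hp, e2x p hp]; ring
  · rw [e2t p hp, e2xx p hp, e1x p hp]; ring
end

section
/- Let μ ∈ ℝ, let θ(x,t) = √3·μ·(x − 2μ·i·t) ∈ ℂ, and let Ω = {(x,t) ∈ ℝ² : cosh θ(x,t) ≠ 0}. Then the functions u₁ = 9μ³·sech²θ·(√3·tanh θ + i) and u₂ = −9μ²·sech²θ satisfy, at every point of Ω, the equations of the second A₂⁽¹⁾-KdV flow: ∂ₜu₁ = ∂ₓ²u₁ − (2/3)∂ₓ³u₂ + (2/3)u₂·∂ₓu₂ and ∂ₜu₂ = −∂ₓ²u₂ + 2∂ₓu₁. -/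
theorem aux_tanh (z : ℂ) (hz : Complex.cosh z ≠ 0) :
    HasDerivAt Complex.tanh (1 - Complex.tanh z ^ 2) z := by
  have h := (Complex.hasDerivAt_sinh z).div (Complex.hasDerivAt_cosh z) hz
  have e : (Complex.sinh / Complex.cosh) = Complex.tanh := by
    funext w; simp [Complex.tanh_eq_sinh_div_cosh]
  rw [e] at h
  have e2 : 1 - Complex.tanh z ^ 2 = (Complex.cosh z * Complex.cosh z -
      Complex.sinh z * Complex.sinh z) / Complex.cosh z ^ 2 := by
    rw [Complex.tanh_eq_sinh_div_cosh]
    field_simp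
  rw [e2]; exact h

theorem aux_sech (z : ℂ) (hz : Complex.cosh z ≠ 0) :
    (1 / Complex.cosh z) ^ 2 = 1 - Complex.tanh z ^ 2 := by
  rw [Complex.tanh_eq_sinh_div_cosh]
  field_simp
  linear_combination - Complex.cosh_sq_sub_sinh_sq z

/-- One-variable chain rule on the set where `cosh` of an affine phase is nonzero. -/
theorem aux_deriv (f : ℝ → ℂ) (a b : ℂ) (G G' : ℂ → ℂ)
    (hG : ∀ w, HasDerivAt G (G' w) w)
    (hf : ∀ y : ℝ, Complex.cosh (a * y + b) ≠ 0 → f y = G (Complex.tanh (a * y + b)))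
    (x : ℝ) (hx : Complex.cosh (a * x + b) ≠ 0) :
    deriv f x = a * (G' (Complex.tanh (a * x + b)) * (1 - Complex.tanh (a * x + b) ^ 2)) := by
  have hc : Continuous (fun y : ℝ => Complex.cosh (a * y + b)) := by fun_prop
  have hev : f =ᶠ[nhds x] fun y : ℝ => G (Complex.tanh (a * y + b)) := by
    filter_upwards [hc.continuousAt.eventually_ne hx] with y hy using hf y hy
  rw [hev.deriv_eq]
  have h1 : HasDerivAt (fun z : ℂ => a * z + b) a (x : ℂ) := by
    simpa using ((hasDerivAt_id (x : ℂ)).const_mul a).add_const b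
  have h2 := ((hG _).comp (x : ℂ) ((aux_tanh _ hx).comp (x : ℂ) h1)).comp_ofReal
  refine (h2.deriv).trans ?_
  simp only [Function.comp_apply]
  ring

/-- The soliton-type complex solution of the second A₂⁽¹⁾-KdV flow built from
`sech` and `tanh` of `θ = √3·μ·(x − 2μit)`. -/
theorem stmt15 (μ : ℝ)
    (θ u₁ u₂ : ℝ × ℝ → ℂ)
    (hθ : ∀ p, θ p = (Real.sqrt 3 : ℂ) * (μ : ℂ) * ((p.1 : ℂ) - 2 * (μ : ℂ) * Complex.I * (p.2 : ℂ)))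
    (hu₁ : ∀ p, u₁ p = 9 * (μ : ℂ) ^ 3 * (1 / Complex.cosh (θ p)) ^ 2 *
        ((Real.sqrt 3 : ℂ) * Complex.tanh (θ p) + Complex.I))
    (hu₂ : ∀ p, u₂ p = -9 * (μ : ℂ) ^ 2 * (1 / Complex.cosh (θ p)) ^ 2) :
    ∀ p : ℝ × ℝ, Complex.cosh (θ p) ≠ 0 →
      (pt u₁ p = px (px u₁) p - (2/3 : ℂ) * px (px (px u₂)) p
          + (2/3 : ℂ) * (u₂ p * px u₂ p) ∧
       pt u₂ p = -(px (px u₂) p) + 2 * px u₁ p) := by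
  have hs : (Real.sqrt 3 : ℂ) ^ 2 = 3 := by
    rw [← Complex.ofReal_pow, Real.sq_sqrt (by norm_num)]; norm_num
  have hI : Complex.I ^ 2 = -1 := Complex.I_sq
  generalize (Real.sqrt 3 : ℂ) = s at *
  have hX : ∀ (f : ℝ × ℝ → ℂ) (G G' : ℂ → ℂ), (∀ w, HasDerivAt G (G' w) w) →
      (∀ p, Complex.cosh (θ p) ≠ 0 → f p = G (Complex.tanh (θ p))) →
      ∀ p, Complex.cosh (θ p) ≠ 0 → px f p =
        s * μ * (G' (Complex.tanh (θ p)) * (1 - Complex.tanh (θ p) ^ 2)) := by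
    intro f G G' hG hf p hp
    have e : ∀ y : ℝ, θ (y, p.2) = (s * μ) * y + s * μ * (-(2 * μ * Complex.I * p.2)) := by
      intro y; rw [hθ]; ring
    have e' := e p.1
    rw [Prod.mk.eta] at e'
    rw [e'] at hp ⊢
    exact aux_deriv (fun x => f (x, p.2)) _ _ G G' hG
      (fun y hy => by rw [← e] at hy ⊢; exact hf _ hy) p.1 hp
  have hT : ∀ (f : ℝ × ℝ → ℂ) (G G' : ℂ → ℂ), (∀ w, HasDerivAt G (G' w) w) →
      (∀ p, Complex.cosh (θ p) ≠ 0 → f p = G (Complex.tanh (θ p))) →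
      ∀ p, Complex.cosh (θ p) ≠ 0 → pt f p =
        (s * μ * (-(2 * μ * Complex.I))) *
          (G' (Complex.tanh (θ p)) * (1 - Complex.tanh (θ p) ^ 2)) := by
    intro f G G' hG hf p hp
    have e : ∀ y : ℝ, θ (p.1, y) = (s * μ * (-(2 * μ * Complex.I))) * y + s * μ * p.1 := by
      intro y; rw [hθ]; ring
    have e' := e p.2
    rw [Prod.mk.eta] at e'
    rw [e'] at hp ⊢
    exact aux_deriv (fun x => f (p.1, x)) _ _ G G' hG
      (fun y hy => by rw [← e] at hy ⊢; exact hf _ hy) p.2 hp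
  have hP : ∀ (P : Polynomial ℂ) (w : ℂ),
      HasDerivAt (fun w => P.eval w) (P.derivative.eval w) w := fun P w => P.hasDerivAt w
  let D : Polynomial ℂ → Polynomial ℂ := fun P =>
    Polynomial.C (s * μ) * (P.derivative * (1 - Polynomial.X ^ 2))
  have hXP : ∀ (f : ℝ × ℝ → ℂ) (P : Polynomial ℂ),
      (∀ p, Complex.cosh (θ p) ≠ 0 → f p = P.eval (Complex.tanh (θ p))) →
      ∀ p, Complex.cosh (θ p) ≠ 0 → px f p = (D P).eval (Complex.tanh (θ p)) := by
    intro f P hf p hp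
    rw [hX f _ _ (hP P) hf p hp]
    simp [D]
  let P₁ : Polynomial ℂ := Polynomial.C (9 * (μ : ℂ) ^ 3) * (1 - Polynomial.X ^ 2) *
    (Polynomial.C s * Polynomial.X + Polynomial.C Complex.I)
  let P₂ : Polynomial ℂ := Polynomial.C (-9 * (μ : ℂ) ^ 2) * (1 - Polynomial.X ^ 2)
  have h1 : ∀ p, Complex.cosh (θ p) ≠ 0 → u₁ p = P₁.eval (Complex.tanh (θ p)) := by
    intro p hp
    rw [hu₁, aux_sech _ hp]; simp [P₁]
  have h2 : ∀ p, Complex.cosh (θ p) ≠ 0 → u₂ p = P₂.eval (Complex.tanh (θ p)) := by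
    intro p hp
    rw [hu₂, aux_sech _ hp]; simp [P₂]
  intro p hp
  have a1 := hXP _ _ h1
  have a2 := hXP _ _ a1
  have b1 := hXP _ _ h2
  have b2 := hXP _ _ b1
  have b3 := hXP _ _ b2
  rw [hT _ _ _ (hP P₁) h1 p hp, hT _ _ _ (hP P₂) h2 p hp, a2 p hp, a1 p hp, b3 p hp, b2 p hp,
    b1 p hp, h2 p hp]
  generalize Complex.tanh (θ p) = T
  have hs3 : s ^ 3 = 3 * s := by linear_combination s * hs
  simp only [D, P₁, P₂, Polynomial.derivative_mul, Polynomial.derivative_add,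
    Polynomial.derivative_sub, Polynomial.derivative_C, Polynomial.derivative_X,
    Polynomial.derivative_one, Polynomial.derivative_X_pow, Polynomial.derivative_zero,
    Polynomial.eval_mul, Polynomial.eval_add, Polynomial.eval_sub, Polynomial.eval_C,
    Polynomial.eval_X, Polynomial.eval_one, Polynomial.eval_pow, Polynomial.eval_zero]
  clear * - hs hI hs3
  generalize (μ : ℂ) = m
  constructor
  · norm_num
    grind
  · norm_num
    grind
end

section
/- Let ν ∈ ℝ, let θ(x,t) = √3·ν·(x + 2νt), and let Ω = {(x,t) ∈ ℝ² : cos θ(x,t) ≠ 0}. Then the real-valued functions u₁ = 9ν³·sec²θ·(1 + √3·tan θ) and u₂ = 9ν²·sec²θ satisfy, at every point of Ω, the equations of the second A₂⁽¹⁾-KdV flow: ∂ₜu₁ = ∂ₓ²u₁ − (2/3)∂ₓ³u₂ + (2/3)u₂·∂ₓu₂ and ∂ₜu₂ = −∂ₓ²u₂ + 2∂ₓu₁. -/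
/-- Partial derivative in the first (space) variable, for real-valued functions. -/
noncomputable def pxR (f : ℝ × ℝ → ℝ) : ℝ × ℝ → ℝ :=
  fun p => deriv (fun x => f (x, p.2)) p.1

/-- Partial derivative in the second (time) variable, for real-valued functions. -/
noncomputable def ptR (f : ℝ × ℝ → ℝ) : ℝ × ℝ → ℝ :=
  fun p => deriv (fun t => f (p.1, t)) p.2

theorem inv_sq_cos_aux {x : ℝ} (h : Real.cos x ≠ 0) :
    1 / Real.cos x ^ 2 = 1 + Real.tan x ^ 2 := by
  rw [Real.tan_eq_sin_div_cos]
  field_simp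
  linarith [Real.sin_sq_add_cos_sq x]

/-- Space derivative of a function that is `F (tan θ)` on the set where `cos θ ≠ 0`. -/
theorem aux_px (ν : ℝ) (θ f : ℝ × ℝ → ℝ) (F F' : ℝ → ℝ)
    (hθ : ∀ p, θ p = Real.sqrt 3 * ν * (p.1 + 2 * ν * p.2))
    (hF : ∀ y, HasDerivAt F (F' y) y)
    (hf : ∀ p, Real.cos (θ p) ≠ 0 → f p = F (Real.tan (θ p))) :
    ∀ p, Real.cos (θ p) ≠ 0 →
      pxR f p = F' (Real.tan (θ p)) * ((1 + Real.tan (θ p) ^ 2) * (Real.sqrt 3 * ν)) := by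
  intro p hp
  have h1 : HasDerivAt (fun x => θ (x, p.2)) (Real.sqrt 3 * ν) p.1 := by
    have e : (fun x => θ (x, p.2)) = fun x => Real.sqrt 3 * ν * (x + 2 * ν * p.2) := by
      funext x; rw [hθ]
    rw [e]
    simpa using ((hasDerivAt_id p.1).add_const (2 * ν * p.2)).const_mul (Real.sqrt 3 * ν)
  have h2 : HasDerivAt (fun x => Real.tan (θ (x, p.2))) _ p.1 :=
    HasDerivAt.comp (h₂ := Real.tan) (h := fun x => θ (x, p.2)) p.1
      (Real.hasDerivAt_tan (x := θ (p.1, p.2)) hp) h1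
  have h3 : HasDerivAt (fun x => F (Real.tan (θ (x, p.2)))) _ p.1 :=
    HasDerivAt.comp (h₂ := F) (h := fun x => Real.tan (θ (x, p.2))) p.1 (hF _) h2
  have h4 : (fun x => f (x, p.2)) =ᶠ[nhds p.1] fun x => F (Real.tan (θ (x, p.2))) := by
    have hc : ContinuousAt (fun x => Real.cos (θ (x, p.2))) p.1 :=
      Real.continuous_cos.continuousAt.comp h1.continuousAt
    filter_upwards [hc.eventually_ne hp] with x hx using hf _ hx
  have h5 := (h3.congr_of_eventuallyEq h4).deriv
  unfold pxR
  rw [h5, ← inv_sq_cos_aux hp]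

/-- Time derivative of a function that is `F (tan θ)` on the set where `cos θ ≠ 0`. -/
theorem aux_pt (ν : ℝ) (θ f : ℝ × ℝ → ℝ) (F F' : ℝ → ℝ)
    (hθ : ∀ p, θ p = Real.sqrt 3 * ν * (p.1 + 2 * ν * p.2))
    (hF : ∀ y, HasDerivAt F (F' y) y)
    (hf : ∀ p, Real.cos (θ p) ≠ 0 → f p = F (Real.tan (θ p))) :
    ∀ p, Real.cos (θ p) ≠ 0 →
      ptR f p = F' (Real.tan (θ p)) *
        ((1 + Real.tan (θ p) ^ 2) * (Real.sqrt 3 * ν * (2 * ν))) := by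
  intro p hp
  have h1 : HasDerivAt (fun x => θ (p.1, x)) (Real.sqrt 3 * ν * (2 * ν)) p.2 := by
    have e : (fun x => θ (p.1, x)) = fun x => Real.sqrt 3 * ν * (p.1 + 2 * ν * x) := by
      funext x; rw [hθ]
    rw [e]
    simpa using (((hasDerivAt_id p.2).const_mul (2 * ν)).const_add p.1).const_mul
      (Real.sqrt 3 * ν)
  have h2 : HasDerivAt (fun x => Real.tan (θ (p.1, x))) _ p.2 :=
    HasDerivAt.comp (h₂ := Real.tan) (h := fun x => θ (p.1, x)) p.2
      (Real.hasDerivAt_tan (x := θ (p.1, p.2)) hp) h1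
  have h3 : HasDerivAt (fun x => F (Real.tan (θ (p.1, x)))) _ p.2 :=
    HasDerivAt.comp (h₂ := F) (h := fun x => Real.tan (θ (p.1, x))) p.2 (hF _) h2
  have h4 : (fun x => f (p.1, x)) =ᶠ[nhds p.2] fun x => F (Real.tan (θ (p.1, x))) := by
    have hc : ContinuousAt (fun x => Real.cos (θ (p.1, x))) p.2 :=
      Real.continuous_cos.continuousAt.comp h1.continuousAt
    filter_upwards [hc.eventually_ne hp] with x hx using hf _ hx
  have h5 := (h3.congr_of_eventuallyEq h4).deriv
  unfold ptR
  rw [h5, ← inv_sq_cos_aux hp]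

/-- The real solution of the second A₂⁽¹⁾-KdV flow built from `sec` and `tan`
of `θ = √3·ν·(x + 2νt)`. -/
theorem stmt16 (ν : ℝ)
    (θ u₁ u₂ : ℝ × ℝ → ℝ)
    (hθ : ∀ p, θ p = Real.sqrt 3 * ν * (p.1 + 2 * ν * p.2))
    (hu₁ : ∀ p, u₁ p = 9 * ν ^ 3 * (1 / Real.cos (θ p)) ^ 2 *
        (1 + Real.sqrt 3 * Real.tan (θ p)))
    (hu₂ : ∀ p, u₂ p = 9 * ν ^ 2 * (1 / Real.cos (θ p)) ^ 2) :
    ∀ p : ℝ × ℝ, Real.cos (θ p) ≠ 0 →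
      (ptR u₁ p = pxR (pxR u₁) p - (2/3 : ℝ) * pxR (pxR (pxR u₂)) p
          + (2/3 : ℝ) * (u₂ p * pxR u₂ p) ∧
       ptR u₂ p = -(pxR (pxR u₂) p) + 2 * pxR u₁ p) := by
  have D : ∀ (P : Polynomial ℝ) (y : ℝ),
      HasDerivAt (fun z => P.eval z) ((fun z => P.derivative.eval z) y) y :=
    fun P y => P.hasDerivAt y
  have step : ∀ (P : Polynomial ℝ) (f : ℝ × ℝ → ℝ),
      (∀ p, Real.cos (θ p) ≠ 0 → f p = P.eval (Real.tan (θ p))) →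
      ∀ p, Real.cos (θ p) ≠ 0 → pxR f p =
        (P.derivative * ((1 + Polynomial.X ^ 2) * Polynomial.C (Real.sqrt 3 * ν))).eval (Real.tan (θ p)) := by
    intro P f hf p hp
    rw [aux_px ν θ f _ _ hθ (D P) hf p hp]
    simp
  have a1 : ∀ p, Real.cos (θ p) ≠ 0 → u₁ p =
      (Polynomial.C (9 * ν ^ 3) * (1 + Polynomial.X ^ 2) * (1 + Polynomial.C (Real.sqrt 3) * Polynomial.X)).eval (Real.tan (θ p)) := by
    intro p hp
    rw [hu₁, one_div_pow, inv_sq_cos_aux hp]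
    simp
  have a2 : ∀ p, Real.cos (θ p) ≠ 0 → u₂ p =
      (Polynomial.C (9 * ν ^ 2) * (1 + Polynomial.X ^ 2)).eval (Real.tan (θ p)) := by
    intro p hp
    rw [hu₂, one_div_pow, inv_sq_cos_aux hp]
    simp
  intro p hp
  have b1 := step _ _ a1
  have c1 := step _ _ b1
  have b2 := step _ _ a2
  have c2 := step _ _ b2
  have d2 := step _ _ c2
  have t1 := aux_pt ν θ u₁ _ _ hθ (D _) a1 p hp
  have t2 := aux_pt ν θ u₂ _ _ hθ (D _) a2 p hp
  rw [t1, t2, c1 p hp, d2 p hp, c2 p hp, b2 p hp, b1 p hp, a2 p hp]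
  have hs : Real.sqrt 3 ^ 2 = 3 := Real.sq_sqrt (by norm_num)
  generalize Real.tan (θ p) = T
  simp [Polynomial.derivative_pow]
  generalize Real.sqrt 3 = s at *
  have hs3 : s ^ 3 = 3 * s := by rw [pow_succ, hs]
  have hs4 : s ^ 4 = 9 := by rw [show s ^ 4 = (s ^ 2) ^ 2 by ring, hs]; norm_num
  constructor
  · ring_nf
    simp only [hs, hs3, hs4]
    ring
  · ring_nf
end
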